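/- Assume that for each fixed (x,t) the map (η_1,…,η_m) ↦ (∂L*/∂η_1,…,∂L*/∂η_m) is invertible, and define the reduced momenta y*_j and reduced Hamiltonian H* accordingly. A C² motion t ↦ x(t) with parameters η_p satisfying the constraints η_α = φ_α satisfies the multiplier-free Poincaré equations d/dt(∂L*/∂η_j) − (K_{0j}^k + K_{qj}^k η_q) ∂L*/∂η_k − X*_j L* − (A_j^α)*(∂L/∂η_α)* = 0 (j = 1,…,m) if and only if the curve (x(t), y*(t)), where y*_j(t) := (∂L*/∂η_j)(η(t), x(t), t), satisfies the Poincaré–Hamilton equations η_j = ∂H*/∂y*_j and ẏ*_j = −X*_j H* + (K_{0j}^k + K_{qj}^k η_q) y*_k + (A_j^α)* (∂L/∂η_α)*. -/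

import Mathlib

open scoped BigOperators

namespace NNH

/-- Full index type for `p, q, r = 1,…,n`: `Sum.inl i` are the independent
indices `i, j, k = 1,…,m` and `Sum.inr α` the dependent ones
`α, β = m+1,…,n` (so `n = m + κ`). -/
abbrev Idx (m κ : ℕ) := Fin m ⊕ Fin κ

variable {m κ : ℕ}

/-- Partial derivative of `f : (ι → ℝ) → ℝ` in the `i`-th coordinate at `v`. -/
noncomputable def pd {ι : Type*} [DecidableEq ι] (f : (ι → ℝ) → ℝ) (i : ι) (v : ι → ℝ) : ℝ :=
  deriv (fun s => f (Function.update v i s)) (v i)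

/-- The operator `X_p G = ξ_p^q ∂G/∂x_q` (differentiation in `x` only). -/
noncomputable def Xp (ξ : Idx m κ → (Idx m κ → ℝ) → Idx m κ → ℝ) (p : Idx m κ)
    (G : (Idx m κ → ℝ) → ℝ → ℝ) : (Idx m κ → ℝ) → ℝ → ℝ :=
  fun x t => ∑ q, ξ p x q * pd (fun v => G v t) q x

/-- The operator `X₀ G = ∂G/∂t + ξ₀^q ∂G/∂x_q`. -/
noncomputable def X0 (ξ0 : (Idx m κ → ℝ) → ℝ → Idx m κ → ℝ)
    (G : (Idx m κ → ℝ) → ℝ → ℝ) : (Idx m κ → ℝ) → ℝ → ℝ :=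
  fun x t => deriv (fun s => G x s) t + ∑ q, ξ0 x t q * pd (fun v => G v t) q x

/-- `∂f/∂η_p` for a function `f(η, x, t)`. -/
noncomputable def pEta (f : (Idx m κ → ℝ) → (Idx m κ → ℝ) → ℝ → ℝ) (p : Idx m κ)
    (η x : Idx m κ → ℝ) (t : ℝ) : ℝ :=
  pd (fun w => f w x t) p η

/-- `∂φ_α/∂η_j`. -/
noncomputable def dphi (φ : Fin κ → (Fin m → ℝ) → (Idx m κ → ℝ) → ℝ → ℝ)
    (α : Fin κ) (j : Fin m) (v : Fin m → ℝ) (x : Idx m κ → ℝ) (t : ℝ) : ℝ :=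
  pd (fun w => φ α w x t) j v

/-- The full vector of Poincaré parameters obtained from the independent ones
`v = (η_1,…,η_m)` by imposing the constraints `η_α = φ_α(v, x, t)`. -/
noncomputable def etaExt (φ : Fin κ → (Fin m → ℝ) → (Idx m κ → ℝ) → ℝ → ℝ)
    (v : Fin m → ℝ) (x : Idx m κ → ℝ) (t : ℝ) : Idx m κ → ℝ :=
  Sum.elim v fun α => φ α v x t

/-- `K_{0j}^s := C_{0j}^s + C_{0β}^s ∂φ_β/∂η_j`. -/
noncomputable def K0 (C0 : Idx m κ → Idx m κ → (Idx m κ → ℝ) → ℝ → ℝ)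
    (φ : Fin κ → (Fin m → ℝ) → (Idx m κ → ℝ) → ℝ → ℝ)
    (j : Fin m) (s : Idx m κ) (v : Fin m → ℝ) (x : Idx m κ → ℝ) (t : ℝ) : ℝ :=
  C0 (.inl j) s x t + ∑ β, C0 (.inr β) s x t * dphi φ β j v x t

/-- `K_{qj}^s := C_{qj}^s + C_{qβ}^s ∂φ_β/∂η_j`. -/
noncomputable def Kq (C : Idx m κ → Idx m κ → Idx m κ → (Idx m κ → ℝ) → ℝ → ℝ)
    (φ : Fin κ → (Fin m → ℝ) → (Idx m κ → ℝ) → ℝ → ℝ)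
    (q : Idx m κ) (j : Fin m) (s : Idx m κ) (v : Fin m → ℝ) (x : Idx m κ → ℝ) (t : ℝ) : ℝ :=
  C q (.inl j) s x t + ∑ β, C q (.inr β) s x t * dphi φ β j v x t

/-- `X*_j G := X_j G + (∂φ_β/∂η_j) X_β G`. -/
noncomputable def Xstar (ξ : Idx m κ → (Idx m κ → ℝ) → Idx m κ → ℝ)
    (φ : Fin κ → (Fin m → ℝ) → (Idx m κ → ℝ) → ℝ → ℝ)
    (j : Fin m) (G : (Idx m κ → ℝ) → ℝ → ℝ)
    (v : Fin m → ℝ) (x : Idx m κ → ℝ) (t : ℝ) : ℝ :=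
  Xp ξ (.inl j) G x t + ∑ β, dphi φ β j v x t * Xp ξ (.inr β) G x t

/-- The reduced Lagrangian `L*(η_1,…,η_m, x, t) = L(η_i, φ_α(η_i,x,t), x, t)`. -/
noncomputable def Lstar (L : (Idx m κ → ℝ) → (Idx m κ → ℝ) → ℝ → ℝ)
    (φ : Fin κ → (Fin m → ℝ) → (Idx m κ → ℝ) → ℝ → ℝ)
    (v : Fin m → ℝ) (x : Idx m κ → ℝ) (t : ℝ) : ℝ :=
  L (etaExt φ v x t) x t

/-- `∂L*/∂η_j`. -/
noncomputable def pLstar (L : (Idx m κ → ℝ) → (Idx m κ → ℝ) → ℝ → ℝ)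
    (φ : Fin κ → (Fin m → ℝ) → (Idx m κ → ℝ) → ℝ → ℝ)
    (j : Fin m) (v : Fin m → ℝ) (x : Idx m κ → ℝ) (t : ℝ) : ℝ :=
  pd (fun w => Lstar L φ w x t) j v

/-- `(A_j^α)*` along a motion `t ↦ (xc t)` with independent parameters `t ↦ vm t`. -/
noncomputable def Astar (ξ : Idx m κ → (Idx m κ → ℝ) → Idx m κ → ℝ)
    (C0 : Idx m κ → Idx m κ → (Idx m κ → ℝ) → ℝ → ℝ)
    (C : Idx m κ → Idx m κ → Idx m κ → (Idx m κ → ℝ) → ℝ → ℝ)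
    (φ : Fin κ → (Fin m → ℝ) → (Idx m κ → ℝ) → ℝ → ℝ)
    (xc : ℝ → Idx m κ → ℝ) (vm : ℝ → Fin m → ℝ)
    (j : Fin m) (α : Fin κ) (t : ℝ) : ℝ :=
  deriv (fun τ => dphi φ α j (vm τ) (xc τ) τ) t
    - Xstar ξ φ j (fun x' t' => φ α (vm t) x' t') (vm t) (xc t) t
    + K0 C0 φ j (.inr α) (vm t) (xc t) t
    + ∑ i, Kq C φ (.inl i) j (.inr α) (vm t) (xc t) t * vm t i
    + ∑ β, Kq C φ (.inr β) j (.inr α) (vm t) (xc t) t * φ β (vm t) (xc t) t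
    - ∑ k', (K0 C0 φ j (.inl k') (vm t) (xc t) t
        + ∑ i, Kq C φ (.inl i) j (.inl k') (vm t) (xc t) t * vm t i
        + ∑ β, Kq C φ (.inr β) j (.inl k') (vm t) (xc t) t * φ β (vm t) (xc t) t)
        * dphi φ α k' (vm t) (xc t) t

/-- Independent part of the Poincaré parameters of a motion. -/
noncomputable def vmOf (η : ℝ → Idx m κ → ℝ) (t : ℝ) : Fin m → ℝ := fun i => η t (.inl i)

/-- Left-hand side of the multiplier-free Poincaré equations of motion
`d/dt(∂L*/∂η_j) − (K_{0j}^k + K_{qj}^k η_q) ∂L*/∂η_k − X*_j L* − (A_j^α)* (∂L/∂η_α)*`. -/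
noncomputable def PoincareLHS (ξ : Idx m κ → (Idx m κ → ℝ) → Idx m κ → ℝ)
    (C0 : Idx m κ → Idx m κ → (Idx m κ → ℝ) → ℝ → ℝ)
    (C : Idx m κ → Idx m κ → Idx m κ → (Idx m κ → ℝ) → ℝ → ℝ)
    (φ : Fin κ → (Fin m → ℝ) → (Idx m κ → ℝ) → ℝ → ℝ)
    (L : (Idx m κ → ℝ) → (Idx m κ → ℝ) → ℝ → ℝ)
    (xc : ℝ → Idx m κ → ℝ) (η : ℝ → Idx m κ → ℝ)
    (j : Fin m) (t : ℝ) : ℝ :=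
  deriv (fun τ => pLstar L φ j (vmOf η τ) (xc τ) τ) t
    - ∑ k', (K0 C0 φ j (.inl k') (vmOf η t) (xc t) t
        + ∑ q, Kq C φ q j (.inl k') (vmOf η t) (xc t) t * η t q)
        * pLstar L φ k' (vmOf η t) (xc t) t
    - Xstar ξ φ j (fun x' t' => Lstar L φ (vmOf η t) x' t') (vmOf η t) (xc t) t
    - ∑ α, Astar ξ C0 C φ xc (vmOf η) j α t
        * pEta L (.inr α) (etaExt φ (vmOf η t) (xc t) t) (xc t) t

/-- The reduced Hamiltonian `H*(x, y*, t) := η_j y*_j − L*`, where `ηhat`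
inverts the Legendre transformation `y*_j = ∂L*/∂η_j`. -/
noncomputable def Hstar (L : (Idx m κ → ℝ) → (Idx m κ → ℝ) → ℝ → ℝ)
    (φ : Fin κ → (Fin m → ℝ) → (Idx m κ → ℝ) → ℝ → ℝ)
    (ηhat : (Idx m κ → ℝ) → (Fin m → ℝ) → ℝ → Fin m → ℝ)
    (x : Idx m κ → ℝ) (y : Fin m → ℝ) (t : ℝ) : ℝ :=
  (∑ j, ηhat x y t j * y j) - Lstar L φ (ηhat x y t) x t


section Auxiliary

open MeasureTheory Metric Set Filter Topology

variable {ι : Type*} [Fintype ι] [DecidableEq ι]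

/-- The Jacobian matrix of a self-map of `ℝ^ι`. -/
noncomputable def jacobian (Q : (ι → ℝ) → ι → ℝ) (z : ι → ℝ) : Matrix ι ι ℝ :=
  LinearMap.toMatrix' (fderiv ℝ Q z : (ι → ℝ) →ₗ[ℝ] ι → ℝ)

theorem jacobian_apply (Q : (ι → ℝ) → ι → ℝ) (z : ι → ℝ) (i k : ι) :
    jacobian Q z i k = fderiv ℝ Q z (Pi.single k 1) i := by
  simp [jacobian, LinearMap.toMatrix'_apply]

theorem det_jacobian (Q : (ι → ℝ) → ι → ℝ) (z : ι → ℝ) :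
    (jacobian Q z).det = (fderiv ℝ Q z).det := by
  simp [jacobian, LinearMap.det_toMatrix']

theorem continuous_jacobian {Q : (ι → ℝ) → ι → ℝ} (hQ : ContDiff ℝ 1 Q) :
    Continuous (jacobian Q) := by
  refine continuous_matrix fun i k => ?_
  simp only [jacobian_apply]
  have := hQ.continuous_fderiv (by norm_num)
  fun_prop

/-- A `C¹` perturbation of the identity of small size, supported in a ball, preserves the
volume of the ball. -/
theorem setIntegral_det_one_add_smul_jacobian {ψ : (ι → ℝ) → ι → ℝ} (hψ : ContDiff ℝ 1 ψ)
    (hc : HasCompactSupport ψ) {R : ℝ} (hR : ∀ z, z ∉ closedBall (0 : ι → ℝ) R → ψ z = 0) :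
    ∃ δ > 0, ∀ t : ℝ, |t| < δ →
      ∫ z in closedBall (0 : ι → ℝ) R, (1 + t • jacobian ψ z).det
        = volume.real (closedBall (0 : ι → ℝ) R) := by
  obtain ⟨K, hK⟩ := hψ.lipschitzWith_of_hasCompactSupport hc (by norm_num)
  have hpos : ∃ ε > 0, ∀ A : (ι → ℝ) →L[ℝ] ι → ℝ, ‖A‖ < ε → 0 < (1 + A).det := by
    have h1 : Continuous fun A : (ι → ℝ) →L[ℝ] ι → ℝ => (1 + A).det :=
      ContinuousLinearMap.continuous_det.comp (continuous_const.add continuous_id)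
    have h2 : ∀ᶠ A in 𝓝 (0 : (ι → ℝ) →L[ℝ] ι → ℝ), 0 < (1 + A).det := by
      refine h1.continuousAt.eventually (lt_mem_nhds ?_)
      have : (1 + 0 : (ι → ℝ) →L[ℝ] ι → ℝ).det = 1 := by
        rw [add_zero]; exact LinearMap.det_id
      show 0 < (1 + 0 : (ι → ℝ) →L[ℝ] ι → ℝ).det
      rw [this]; norm_num
    obtain ⟨ε, hε, h⟩ := Metric.eventually_nhds_iff.1 h2
    exact ⟨ε, hε, fun A hA => h (by simpa using hA)⟩
  obtain ⟨ε, hε, hdet⟩ := hpos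
  refine ⟨min 1 ε / (K + 1), by positivity, fun t ht => ?_⟩
  have hK1 : (0 : ℝ) < K + 1 := by positivity
  have htK : |t| * K < min 1 ε := by
    rw [lt_div_iff₀ hK1] at ht
    nlinarith [abs_nonneg t]
  set f : (ι → ℝ) → ι → ℝ := fun z => z + t • ψ z with hf
  have hfd : ∀ z, HasFDerivAt f (1 + t • fderiv ℝ ψ z) z := fun z =>
    (hasFDerivAt_id z).add (((hψ.differentiable (by norm_num)) z).hasFDerivAt.const_smul t)
  have hlip : LipschitzWith (‖t‖₊ * K) fun z => t • ψ z := by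
    refine LipschitzWith.of_dist_le_mul fun x y => ?_
    rw [dist_smul₀]
    have := hK.dist_le_mul x y
    push_cast
    rw [mul_assoc]
    exact mul_le_mul_of_nonneg_left this (norm_nonneg _)
  have hlt : ‖t‖₊ * K < 1 := by
    rw [← NNReal.coe_lt_coe]; push_cast
    rw [Real.norm_eq_abs]; exact htK.trans_le (min_le_left _ _)
  have hinj : Function.Injective f := by
    intro x y hxy
    by_contra hne
    have h1 : dist x y = dist (t • ψ x) (t • ψ y) := by
      have : x - y = t • ψ y - t • ψ x := by
        have : x + t • ψ x = y + t • ψ y := hxy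
        rw [sub_eq_sub_iff_add_eq_add, this, add_comm]
      rw [dist_eq_norm, this, dist_eq_norm, norm_sub_rev]
    have h2 := hlip.dist_le_mul x y
    rw [← h1] at h2
    have h3 : 0 < dist x y := dist_pos.2 hne
    have h4 : ((‖t‖₊ * K : NNReal) : ℝ) < 1 := by exact_mod_cast hlt
    nlinarith
  have hsurj : Function.Surjective f := by
    intro y
    have hcon : ContractingWith (‖t‖₊ * K) fun z => y - t • ψ z := by
      refine ⟨hlt, LipschitzWith.of_dist_le_mul fun a b => ?_⟩
      rw [dist_sub_left]
      exact hlip.dist_le_mul a b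
    refine ⟨hcon.fixedPoint, ?_⟩
    have := hcon.fixedPoint_isFixedPt
    have h : y - t • ψ hcon.fixedPoint = hcon.fixedPoint := this
    show hcon.fixedPoint + t • ψ hcon.fixedPoint = y
    nth_rewrite 1 [← h]; simp
  have hout : ∀ z, z ∉ closedBall (0 : ι → ℝ) R → f z = z := fun z hz => by simp [hf, hR z hz]
  have himage : f '' closedBall 0 R = closedBall 0 R := by
    apply Subset.antisymm
    · rintro _ ⟨x, hx, rfl⟩
      by_contra hn
      exact hn ((hinj (hout _ hn)).symm ▸ hx)
    · intro y hy
      obtain ⟨x, rfl⟩ := hsurj y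
      by_contra hn
      have hx : x ∉ closedBall (0 : ι → ℝ) R := fun h => hn ⟨x, h, rfl⟩
      rw [hout x hx] at hy
      exact hx hy
  have hcv := integral_image_eq_integral_abs_det_fderiv_smul volume
    (measurableSet_closedBall (x := (0 : ι → ℝ)) (ε := R))
    (fun z _ => (hfd z).hasFDerivWithinAt) hinj.injOn fun _ => (1 : ℝ)
  rw [himage] at hcv
  simp only [smul_eq_mul, mul_one, setIntegral_const] at hcv
  rw [hcv]
  refine setIntegral_congr_fun measurableSet_closedBall fun z _ => ?_
  have hsm : ‖t • fderiv ℝ ψ z‖ < ε := by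
    rw [norm_smul]
    have := norm_fderiv_le_of_lipschitz ℝ hK (x₀ := z)
    exact ((mul_le_mul_of_nonneg_left this (norm_nonneg t)).trans_lt htK).trans_le (min_le_right _ _)
  show _ = |_|
  rw [abs_of_pos (hdet _ hsm), ContinuousLinearMap.det, ← LinearMap.det_toMatrix']
  congr 1
  ext i k
  simp [jacobian_apply, LinearMap.toMatrix'_apply, Matrix.one_apply, Pi.single_apply]

/-- The integral of the Jacobian determinant of a compactly supported `C¹` map vanishes. -/
theorem integral_det_jacobian_eq_zero [Nonempty ι] {ψ : (ι → ℝ) → ι → ℝ}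
    (hψ : ContDiff ℝ 1 ψ) (hc : HasCompactSupport ψ) :
    ∫ z, (jacobian ψ z).det = 0 := by
  obtain ⟨R, hR⟩ := hc.isCompact.isBounded.subset_closedBall (0 : ι → ℝ)
  have hout : ∀ z, z ∉ closedBall (0 : ι → ℝ) R → ψ z = 0 := fun z hz =>
    image_eq_zero_of_notMem_tsupport fun h => hz (hR h)
  obtain ⟨δ, hδ, h⟩ := setIntegral_det_one_add_smul_jacobian hψ hc hout
  set N := Fintype.card ι with hN
  have hNpos : 0 < N := Fintype.card_pos
  set v : ℕ → ℝ := fun j => δ / (N + 1) * j with hv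
  have hvinj : InjOn v (Finset.range (N + 1) : Finset ℕ) := fun a _ b _ hab => by
    have : δ / (N + 1) ≠ 0 := by positivity
    exact_mod_cast mul_left_cancel₀ this hab
  have hvlt : ∀ j ∈ Finset.range (N + 1), |v j| < δ := fun j hj => by
    have hj' : (j : ℝ) < N + 1 := by exact_mod_cast Finset.mem_range.1 hj
    rw [abs_of_nonneg (by positivity), hv]
    simp only
    rw [div_mul_eq_mul_div, div_lt_iff₀ (by positivity)]
    nlinarith
  set w : ℕ → ℝ := fun j => ∏ k ∈ (Finset.range (N + 1)).erase j, (v j - v k) with hw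
  have hlead : ∀ P : Polynomial ℝ, P.degree < (N + 1 : ℕ) →
      P.coeff N = ∑ j ∈ Finset.range (N + 1), P.eval (v j) / w j := fun P hP => by
    have := Lagrange.coeff_eq_sum hvinj (P := P) (by simpa using hP)
    simpa using this
  have hpt : ∀ z, (jacobian ψ z).det
      = ∑ j ∈ Finset.range (N + 1), (1 + v j • jacobian ψ z).det / w j := fun z => by
    rw [← Polynomial.coeff_det_X_add_C_card (jacobian ψ z) 1, hlead]
    · refine Finset.sum_congr rfl fun j _ => ?_
      congr 1
      rw [← Polynomial.coe_evalRingHom, RingHom.map_det]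
      congr 1
      ext i k
      by_cases hik : i = k <;> simp [hik, mul_comm (v j), add_comm (1 : ℝ)]
    · refine Polynomial.degree_le_natDegree.trans_lt ?_
      exact_mod_cast Nat.lt_succ_of_le (Polynomial.natDegree_det_X_add_C_le _ _)
  have hone : ∑ j ∈ Finset.range (N + 1), 1 / w j = 0 := by
    have := hlead 1 (by
      refine Polynomial.degree_one_le.trans_lt ?_
      exact_mod_cast Nat.succ_pos N)
    simp only [Polynomial.eval_one] at this
    rw [← this, Polynomial.coeff_one, if_neg hNpos.ne']
  have hJ := continuous_jacobian hψ
  rw [← setIntegral_eq_integral_of_forall_compl_eq_zero (s := closedBall (0 : ι → ℝ) R)]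
  · simp_rw [hpt]
    rw [integral_finsetSum]
    · calc _ = ∑ j ∈ Finset.range (N + 1), volume.real (closedBall (0 : ι → ℝ) R) * (1 / w j) := by
            refine Finset.sum_congr rfl fun j hj => ?_
            rw [integral_div, h _ (hvlt j hj), mul_one_div]
        _ = 0 := by rw [← Finset.mul_sum, hone, mul_zero]
    · intro j _
      refine ContinuousOn.integrableOn_compact (isCompact_closedBall _ _) ?_
      fun_prop
  · intro z hz
    have : jacobian ψ z = 0 := by
      have hz' : z ∉ tsupport ψ := fun h => hz (hR h)
      ext i k
      rw [jacobian_apply, image_eq_zero_of_notMem_tsupport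
        (fun h => hz' (tsupport_fderiv_subset ℝ h))]
      simp
    rw [this, Matrix.det_zero]

theorem apply_eq_sum_single (A : (ι → ℝ) →L[ℝ] ℝ) (e : ι → ℝ) :
    A e = ∑ k, e k * A (Pi.single k 1) := by
  conv_lhs => rw [pi_eq_sum_univ' e]
  rw [map_sum]
  refine Finset.sum_congr rfl fun k _ => ?_
  rw [map_smul, smul_eq_mul]

theorem fderiv_apply_coord {Q : (ι → ℝ) → ι → ℝ} {z : ι → ℝ} (hQ : DifferentiableAt ℝ Q z)
    (i : ι) (v : ι → ℝ) : fderiv ℝ Q z v i = fderiv ℝ (fun x => Q x i) z v := by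
  rw [(hasFDerivAt_pi'.1 hQ.hasFDerivAt i).fderiv, ContinuousLinearMap.comp_apply,
    ContinuousLinearMap.proj_apply]

/-- Replacing one row of a Jacobian matrix by the gradient of a compactly supported function
yields a determinant of vanishing integral. -/
theorem integral_det_updateRow_jacobian_eq_zero {Q : (ι → ℝ) → ι → ℝ} (hQ : ContDiff ℝ 1 Q)
    {u : (ι → ℝ) → ℝ} (hu : ContDiff ℝ 1 u) (hc : HasCompactSupport u) (i : ι) :
    ∫ z, ((jacobian Q z).updateRow i fun k => fderiv ℝ u z (Pi.single k 1)).det = 0 := by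
  have : Nonempty ι := ⟨i⟩
  obtain ⟨R, hR0, hR⟩ := hc.isCompact.isBounded.subset_closedBall_lt 0 (0 : ι → ℝ)
  let χ : ContDiffBump (0 : ι → ℝ) := ⟨R + 1, R + 2, by linarith, by linarith⟩
  have hχ : ContDiff ℝ 1 χ := χ.contDiff
  set ψ : (ι → ℝ) → ι → ℝ := fun z => Function.update (χ z • Q z) i (u z) with hψdef
  have hQj : ∀ j, ContDiff ℝ 1 fun z => Q z j := contDiff_pi.1 hQ
  have hψ : ContDiff ℝ 1 ψ := by
    refine contDiff_pi.2 fun j => ?_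
    by_cases hj : j = i
    · subst hj; simpa [hψdef] using hu
    · simpa [hψdef, hj] using hχ.mul (hQj j)
  have hu0 : ∀ z, z ∉ closedBall (0 : ι → ℝ) R → u =ᶠ[𝓝 z] 0 := fun z hz =>
    notMem_tsupport_iff_eventuallyEq.1 fun h => hz (hR h)
  have hψc : HasCompactSupport ψ := by
    refine HasCompactSupport.intro (isCompact_closedBall (0 : ι → ℝ) (R + 2)) fun z hz => ?_
    have h1 : χ z = 0 := χ.zero_of_le_dist (not_le.1 fun h => hz h).le
    have h2 : u z = 0 := (hu0 z fun h => hz (closedBall_subset_closedBall (by linarith) h)).eq_of_nhds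
    ext j
    by_cases hj : j = i
    · subst hj; simp [hψdef, h2]
    · simp [hψdef, hj, h1]
  rw [← integral_det_jacobian_eq_zero hψ hψc]
  refine integral_congr_ae (Eventually.of_forall fun z => ?_)
  have hrow : ∀ k, jacobian ψ z i k = fderiv ℝ u z (Pi.single k 1) := fun k => by
    rw [jacobian_apply, fderiv_apply_coord (hψ.differentiable (by norm_num) z)]
    simp [hψdef]
  by_cases hz : z ∈ closedBall (0 : ι → ℝ) R
  · show Matrix.det _ = Matrix.det _
    congr 1
    ext j k
    by_cases hj : j = i
    · subst hj; rw [Matrix.updateRow_self, hrow]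
    · rw [Matrix.updateRow_ne hj, jacobian_apply, jacobian_apply,
        fderiv_apply_coord (hψ.differentiable (by norm_num) z),
        fderiv_apply_coord (hQ.differentiable (by norm_num) z)]
      refine congrArg (fun A : (ι → ℝ) →L[ℝ] ℝ => A (Pi.single k 1)) (Filter.EventuallyEq.fderiv_eq ?_)
      have : z ∈ ball (0 : ι → ℝ) χ.rIn := closedBall_subset_ball (by show R < R + 1; linarith) hz
      filter_upwards [χ.eventuallyEq_one_of_mem_ball this] with x hx
      simp [hψdef, hj, hx]
  · have h0 : ∀ k, fderiv ℝ u z (Pi.single k 1) = 0 := fun k => by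
      rw [(hu0 z hz).fderiv_eq]; simp
    show Matrix.det _ = Matrix.det _
    rw [Matrix.det_eq_zero_of_row_eq_zero i (by simpa using h0),
      Matrix.det_eq_zero_of_row_eq_zero i (fun k => by rw [hrow, h0])]

theorem integrableOn_pi_ball {f : (ι → ℝ) → ℝ} (hf : Continuous f) (z : ι → ℝ) (ρ : ℝ) :
    IntegrableOn f (ball z ρ) :=
  (hf.continuousOn.integrableOn_compact (isCompact_closedBall z ρ)).mono_set ball_subset_closedBall

/-- Integration by parts on a ball `B` for the pull-back under `Q` of a function `g` whose support
avoids `Q (∂B)`, weighted by a function `F` with `dF = ∑ₖ aₖ dQₖ`. -/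
theorem setIntegral_ball_pullback_eq_zero {Q : (ι → ℝ) → ι → ℝ} (hQ : ContDiff ℝ 1 Q)
    {F : (ι → ℝ) → ℝ} (hF : ContDiff ℝ 1 F) {a : (ι → ℝ) → ι → ℝ} (ha : Continuous a)
    (hFa : ∀ z v, fderiv ℝ F z v = ∑ k, a z k * fderiv ℝ Q z v k)
    {g : (ι → ℝ) → ℝ} (hg : ContDiff ℝ 1 g) {z₀ : ι → ℝ} {ρ : ℝ}
    (hsupp : ∀ z ∈ sphere z₀ ρ, Q z ∉ tsupport g) (e : ι → ℝ) :
    ∫ z in ball z₀ ρ, ((∑ i, a z i * e i) * g (Q z) + F z * fderiv ℝ g (Q z) e)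
      * (jacobian Q z).det = 0 := by
  have hJ := continuous_jacobian hQ
  have hQc := hQ.continuous
  have hg' := hg.continuous_fderiv (by norm_num)
  set c : (ι → ℝ) → ι → ℝ := fun z k => a z k * g (Q z) + F z * fderiv ℝ g (Q z) (Pi.single k 1)
    with hc
  have hcc : ∀ i, Continuous fun z => c z i * (jacobian Q z).det := fun i => by
    have h1 : Continuous fun z => a z i := (continuous_apply i).comp ha
    have h2 : Continuous fun z => fderiv ℝ g (Q z) (Pi.single i 1) :=
      (hg'.comp hQc).clm_apply continuous_const
    exact ((h1.mul (hg.continuous.comp hQc)).add (hF.continuous.mul h2)).mul hJ.matrix_det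
  set u : (ι → ℝ) → ℝ := (ball z₀ ρ).indicator fun z => F z * g (Q z) with hu
  have hu1 : ∀ z ∈ ball z₀ ρ, u =ᶠ[𝓝 z] fun z => F z * g (Q z) := fun z hz => by
    filter_upwards [isOpen_ball.mem_nhds hz] with x hx
    simp [hu, indicator_of_mem hx]
  have hu0 : ∀ z, z ∉ ball z₀ ρ → u =ᶠ[𝓝 z] 0 := fun z hz => by
    by_cases hz' : z ∈ sphere z₀ ρ
    · have := hQc.continuousAt.eventually (notMem_tsupport_iff_eventuallyEq.1 (hsupp z hz'))
      filter_upwards [this] with x hx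
      have hx' : g (Q x) = 0 := hx
      simp [hu, indicator, hx']
    · have : z ∉ closedBall z₀ ρ := fun h => by
        rcases (mem_closedBall.1 h).lt_or_eq with h | h
        · exact hz h
        · exact hz' h
      filter_upwards [isClosed_closedBall.isOpen_compl.mem_nhds this] with x hx
      exact indicator_of_notMem (fun h => hx (ball_subset_closedBall h)) _
  have huC : ContDiff ℝ 1 u := contDiff_iff_contDiffAt.2 fun z => by
    by_cases hz : z ∈ ball z₀ ρ
    · exact (hF.mul (hg.comp hQ)).contDiffAt.congr_of_eventuallyEq (hu1 z hz)
    · exact (contDiff_const (c := (0 : ℝ))).contDiffAt.congr_of_eventuallyEq (hu0 z hz)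
  have huc : HasCompactSupport u :=
    HasCompactSupport.intro (isCompact_closedBall z₀ ρ) fun z hz =>
      indicator_of_notMem (fun h => hz (ball_subset_closedBall h)) _
  have hrow : ∀ i, ∫ z in ball z₀ ρ, c z i * (jacobian Q z).det = 0 := fun i => by
    have key := integral_det_updateRow_jacobian_eq_zero hQ huC huc i
    rw [← setIntegral_eq_integral_of_forall_compl_eq_zero (s := ball z₀ ρ)] at key
    · rw [← key]
      refine setIntegral_congr_fun measurableSet_ball fun z hz => ?_
      have hder : ∀ v, fderiv ℝ u z v = ∑ k, c z k * fderiv ℝ Q z v k := fun v => by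
        have hQd := (hQ.differentiable (by norm_num) z).hasFDerivAt
        have hgd := (hg.differentiable (by norm_num) (Q z)).hasFDerivAt
        have hFd := (hF.differentiable (by norm_num) z).hasFDerivAt
        have hprod : HasFDerivAt (fun z => F z * g (Q z)) _ z := hFd.mul (hgd.comp z hQd)
        rw [(hu1 z hz).fderiv_eq, hprod.fderiv]
        simp only [add_apply, smul_apply, smul_eq_mul,
          ContinuousLinearMap.comp_apply,
          apply_eq_sum_single (fderiv ℝ g (Q z)) (fderiv ℝ Q z v), hFa, Finset.mul_sum]
        rw [← Finset.sum_add_distrib]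
        refine Finset.sum_congr rfl fun k _ => ?_
        simp only [hc]; ring
      show c z i * _ = _
      rw [← smul_eq_mul, ← Matrix.det_updateRow_sum]
      congr 2
      ext k
      simp only [hder, Finset.sum_apply, Pi.smul_apply, smul_eq_mul, jacobian_apply]
    · intro z hz
      refine Matrix.det_eq_zero_of_row_eq_zero i fun k => ?_
      rw [Matrix.updateRow_self, (hu0 z hz).fderiv_eq]; simp
  have hsum : ∀ z, ((∑ i, a z i * e i) * g (Q z) + F z * fderiv ℝ g (Q z) e)
      * (jacobian Q z).det = ∑ i, e i * (c z i * (jacobian Q z).det) := fun z => by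
    rw [apply_eq_sum_single (fderiv ℝ g (Q z)) e, Finset.sum_mul, Finset.mul_sum, ← Finset.sum_add_distrib, Finset.sum_mul]
    refine Finset.sum_congr rfl fun k _ => ?_
    simp only [hc]; ring
  simp_rw [hsum]
  rw [integral_finsetSum]
  · refine Finset.sum_eq_zero fun i _ => ?_
    rw [integral_const_mul, hrow i, mul_zero]
  · intro i _
    exact (integrableOn_pi_ball (hcc i) z₀ ρ).const_mul _

/-- Translating the test function: the derivative of the `F`-weighted pull-back in the direction
`e` is the pull-back weighted by the directional derivative `∑ₖ aₖ eₖ` of `F` along `Q`. -/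
theorem hasDerivAt_setIntegral_ball_translate {Q : (ι → ℝ) → ι → ℝ} (hQ : ContDiff ℝ 1 Q)
    {F : (ι → ℝ) → ℝ} (hF : ContDiff ℝ 1 F) {a : (ι → ℝ) → ι → ℝ} (ha : Continuous a)
    (hFa : ∀ z v, fderiv ℝ F z v = ∑ k, a z k * fderiv ℝ Q z v k)
    {g : (ι → ℝ) → ℝ} (hg : ContDiff ℝ 1 g) {z₀ : ι → ℝ} {ρ : ℝ} {y e : ι → ℝ} {τ : ℝ}
    (hsupp : ∀ z ∈ sphere z₀ ρ, Q z - (y + τ • e) ∉ tsupport g) :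
    HasDerivAt (fun s : ℝ => ∫ z in ball z₀ ρ, F z * g (Q z - (y + s • e)) * (jacobian Q z).det)
      (∫ z in ball z₀ ρ, (∑ i, a z i * e i) * g (Q z - (y + τ • e)) * (jacobian Q z).det) τ := by
  have hJ : Continuous fun z => (jacobian Q z).det := (continuous_jacobian hQ).matrix_det
  have hQc := hQ.continuous
  have hFc := hF.continuous
  have hgc := hg.continuous
  have hg' := hg.continuous_fderiv (by norm_num)
  have hcont' : Continuous fun p : ℝ × (ι → ℝ) =>
      F p.2 * (-fderiv ℝ g (Q p.2 - (y + p.1 • e)) e) * (jacobian Q p.2).det := by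
    have h1 : Continuous fun p : ℝ × (ι → ℝ) => fderiv ℝ g (Q p.2 - (y + p.1 • e)) e :=
      (hg'.comp (by fun_prop)).clm_apply continuous_const
    exact ((hFc.comp continuous_snd).mul h1.neg).mul (hJ.comp continuous_snd)
  obtain ⟨M, hM⟩ := ((isCompact_closedBall τ 1).prod
    (isCompact_closedBall z₀ ρ)).exists_bound_of_continuousOn hcont'.continuousOn
  have hmain := (hasDerivAt_integral_of_dominated_loc_of_deriv_le
    (μ := volume.restrict (ball z₀ ρ)) (x₀ := τ) (s := ball τ 1) (bound := fun _ => M)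
    (F := fun s z => F z * g (Q z - (y + s • e)) * (jacobian Q z).det)
    (F' := fun s z => F z * (-fderiv ℝ g (Q z - (y + s • e)) e) * (jacobian Q z).det)
    (ball_mem_nhds τ one_pos)
    (Eventually.of_forall fun s => Continuous.aestronglyMeasurable (by fun_prop))
    (integrableOn_pi_ball (by fun_prop) z₀ ρ)
    (Continuous.aestronglyMeasurable (hcont'.comp (Continuous.prodMk_right τ)))
    (by
      refine (ae_restrict_mem measurableSet_ball).mono fun z hz s hs => ?_
      exact hM (s, z) ⟨ball_subset_closedBall hs, ball_subset_closedBall hz⟩)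
    (integrableOn_pi_ball continuous_const z₀ ρ)
    (by
      refine Eventually.of_forall fun z s _ => ?_
      have h1 : HasDerivAt (fun s : ℝ => Q z - (y + s • e)) (-e) s := by
        simpa using (((hasDerivAt_id s).smul_const e).const_add y).const_sub (Q z)
      have h2 := ((hg.differentiable (by norm_num) _).hasFDerivAt).comp_hasDerivAt s h1
      simpa using (h2.const_mul (F z)).mul_const _)).2
  refine hmain.congr_deriv ?_
  symm
  have hg2 : ContDiff ℝ 1 fun w => g (w - (y + τ • e)) :=
    hg.comp (contDiff_id.sub contDiff_const)
  have hst := setIntegral_ball_pullback_eq_zero hQ hF ha hFa hg2 (z₀ := z₀) (ρ := ρ)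
    (fun z hz => by
      rw [notMem_tsupport_iff_eventuallyEq]
      have hc : ContinuousAt (fun w : ι → ℝ => w - (y + τ • e)) (Q z) := by fun_prop
      exact hc.eventually (notMem_tsupport_iff_eventuallyEq.1 (hsupp z hz))) e
  rw [← sub_eq_zero, ← integral_sub]
  · rw [← hst]
    refine integral_congr_ae (Eventually.of_forall fun z => ?_)
    simp only [fderiv_comp_sub]
    ring
  · refine integrableOn_pi_ball ?_ z₀ ρ
    fun_prop
  · exact integrableOn_pi_ball (hcont'.comp (Continuous.prodMk_right τ)) z₀ ρ

/-- The signed mass of the translate by `y` of `g`, pulled back under `Q` to the ball. -/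
noncomputable def pullbackMass (Q : (ι → ℝ) → ι → ℝ) (z₀ : ι → ℝ) (ρ : ℝ) (g : (ι → ℝ) → ℝ)
    (y : ι → ℝ) : ℝ :=
  ∫ z in ball z₀ ρ, g (Q z - y) * (jacobian Q z).det

theorem sub_notMem_tsupport_of_dist_lt {Q : (ι → ℝ) → ι → ℝ} {z₀ z y₀ y : ι → ℝ} {ρ r : ℝ}
    (hr : ∀ z ∈ sphere z₀ ρ, r ≤ dist (Q z) y₀) (hz : z ∈ sphere z₀ ρ)
    {g : ContDiffBump (0 : ι → ℝ)} (hy : dist y y₀ + g.rOut < r) : Q z - y ∉ tsupport g := by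
  rw [g.tsupport_eq, mem_closedBall_zero_iff, not_le, ← dist_eq_norm]
  linarith [hr z hz, dist_triangle (Q z) y y₀]

theorem pullbackMass_eq {Q : (ι → ℝ) → ι → ℝ} (hQ : ContDiff ℝ 1 Q) {z₀ y₀ : ι → ℝ} {ρ r : ℝ}
    (hr : ∀ z ∈ sphere z₀ ρ, r ≤ dist (Q z) y₀) (g : ContDiffBump (0 : ι → ℝ)) {y y' : ι → ℝ}
    (hy : dist y y₀ + g.rOut < r) (hy' : dist y' y₀ + g.rOut < r) :
    pullbackMass Q z₀ ρ g y' = pullbackMass Q z₀ ρ g y := by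
  have hder : ∀ τ ∈ Icc (0 : ℝ) 1,
      HasDerivAt (fun s : ℝ => pullbackMass Q z₀ ρ g (y + s • (y' - y))) 0 τ := fun τ hτ => by
    have hmem : y + τ • (y' - y) ∈ ball y₀ (r - g.rOut) :=
      (convex_ball y₀ (r - g.rOut)).add_smul_sub_mem (mem_ball.2 (by linarith))
        (mem_ball.2 (by linarith)) hτ
    have h := hasDerivAt_setIntegral_ball_translate hQ (F := fun _ => (1 : ℝ)) contDiff_const
      (a := fun _ _ => 0) continuous_const (fun z v => by simp) (g.contDiff (n := 1))
      (z₀ := z₀) (ρ := ρ) (y := y) (e := y' - y) (τ := τ)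
      (fun z hz => sub_notMem_tsupport_of_dist_lt hr hz (by linarith [mem_ball.1 hmem]))
    simpa [pullbackMass] using h
  have := constant_of_has_deriv_right_zero (fun τ hτ => (hder τ hτ).continuousAt.continuousWithinAt)
    (fun τ hτ => (hder τ (Ico_subset_Icc_self hτ)).hasDerivWithinAt) 1 (right_mem_Icc.2 zero_le_one)
  simpa using this

theorem pullbackMass_eq_zero {Q : (ι → ℝ) → ι → ℝ} {z₀ y : ι → ℝ} {ρ : ℝ}
    {g : ContDiffBump (0 : ι → ℝ)}
    (h : ∀ z ∈ ball z₀ ρ, dist (Q z) y < g.rOut → (jacobian Q z).det = 0) :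
    pullbackMass Q z₀ ρ g y = 0 := by
  refine setIntegral_eq_zero_of_forall_eq_zero fun z hz => ?_
  by_cases hd : dist (Q z) y < g.rOut
  · rw [h z hz hd, mul_zero]
  · rw [g.zero_of_le_dist (by simpa [dist_eq_norm] using hd), zero_mul]

theorem mul_pullbackMass_pos {Q : (ι → ℝ) → ι → ℝ} (hQ : ContDiff ℝ 1 Q) {z₀ y : ι → ℝ} {ρ c : ℝ}
    {g : ContDiffBump (0 : ι → ℝ)}
    (h : ∀ z ∈ ball z₀ ρ, dist (Q z) y < g.rOut → 0 ≤ c * (jacobian Q z).det)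
    (hex : ∃ z ∈ ball z₀ ρ, dist (Q z) y < g.rOut ∧ c * (jacobian Q z).det ≠ 0) :
    0 < c * pullbackMass Q z₀ ρ g y := by
  have hJ : Continuous fun z => (jacobian Q z).det := (continuous_jacobian hQ).matrix_det
  have hQc := hQ.continuous
  have hgc := g.continuous
  have hcont : Continuous fun z => c * (g (Q z - y) * (jacobian Q z).det) := by fun_prop
  rw [pullbackMass, ← integral_const_mul, setIntegral_pos_iff_support_of_nonneg_ae]
  · refine (IsOpen.measure_pos volume (hcont.isOpen_support.inter isOpen_ball) ?_)
    obtain ⟨z, hz, hd, hne⟩ := hex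
    refine ⟨z, ?_, hz⟩
    have hgpos : 0 < g (Q z - y) := g.pos_of_mem_ball (by simpa [dist_eq_norm] using hd)
    have : c * (g (Q z - y) * (jacobian Q z).det) = g (Q z - y) * (c * (jacobian Q z).det) := by
      ring
    rw [Function.mem_support, this]
    exact mul_ne_zero hgpos.ne' hne
  · refine (ae_restrict_mem measurableSet_ball).mono fun z hz => ?_
    by_cases hd : dist (Q z) y < g.rOut
    · have := mul_nonneg (g.nonneg (x := Q z - y)) (h z hz hd)
      show 0 ≤ c * (g (Q z - y) * (jacobian Q z).det)
      linarith
    · show 0 ≤ c * (g (Q z - y) * (jacobian Q z).det)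
      rw [g.zero_of_le_dist (by simpa [dist_eq_norm] using hd)]; simp
  · exact integrableOn_pi_ball hcont z₀ ρ

/-- A continuous injective map separates a point of a compact set from the complement of a
neighbourhood, quantitatively in the target. -/
theorem exists_dist_lt_imp_mem {X Y : Type*} [TopologicalSpace X] [MetricSpace Y] {Q : X → Y}
    (hQ : Continuous Q) (hinj : Function.Injective Q) {K : Set X} (hK : IsCompact K) {z : X}
    {V : Set X} (hV : V ∈ 𝓝 z) :
    ∃ ε > 0, ∀ x ∈ K, dist (Q x) (Q z) < ε → x ∈ V := by
  have hcl : IsClosed (Q '' (K \ interior V)) :=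
    ((hK.diff isOpen_interior).image hQ).isClosed
  have hn : Q z ∈ (Q '' (K \ interior V))ᶜ := by
    rintro ⟨x, hx, hxz⟩
    exact hx.2 (hinj hxz ▸ mem_interior_iff_mem_nhds.2 hV)
  obtain ⟨ε, hε, h⟩ := Metric.isOpen_iff.1 hcl.isOpen_compl _ hn
  refine ⟨ε, hε, fun x hx hd => ?_⟩
  by_contra hxV
  exact h (mem_ball.2 hd) ⟨x, ⟨hx, fun hi => hxV (interior_subset hi)⟩, rfl⟩

/-- The bump function at the origin with support of radius `ε`. -/
noncomputable def bumpAtZero (ε : ℝ) (hε : 0 < ε) : ContDiffBump (0 : ι → ℝ) :=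
  ⟨ε / 2, ε, half_pos hε, half_lt_self hε⟩

section Local

variable {Q : (ι → ℝ) → ι → ℝ} {z₀ y₀ : ι → ℝ} {ρ r : ℝ}

theorem exists_mul_pullbackMass_pos (hQ : ContDiff ℝ 1 Q) (hinj : Function.Injective Q)
    (hr : ∀ z ∈ sphere z₀ ρ, r ≤ dist (Q z) y₀) {z₁ : ι → ℝ} (hz₁ : z₁ ∈ ball z₀ ρ)
    (hQz₁ : dist (Q z₁) y₀ < r) (hJ₁ : (jacobian Q z₁).det ≠ 0) {y : ι → ℝ} (hy : dist y y₀ < r) :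
    ∃ ε > 0, ∀ g : ContDiffBump (0 : ι → ℝ), g.rOut < ε →
      0 < (jacobian Q z₁).det * pullbackMass Q z₀ ρ g y := by
  have hJ : Continuous fun z => (jacobian Q z).det := (continuous_jacobian hQ).matrix_det
  have hV : {z | 0 < (jacobian Q z₁).det * (jacobian Q z).det} ∈ 𝓝 z₁ :=
    (isOpen_lt continuous_const (continuous_const.mul hJ)).mem_nhds (mul_self_pos.2 hJ₁)
  obtain ⟨ε, hε, h⟩ := exists_dist_lt_imp_mem hQ.continuous hinj (isCompact_closedBall z₀ ρ) hV
  refine ⟨min ε (min (r - dist y y₀) (r - dist (Q z₁) y₀)),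
    lt_min hε (lt_min (by linarith) (by linarith)), fun g hg => ?_⟩
  have h1 := hg.trans_le (min_le_left _ _)
  have h2 := (hg.trans_le (min_le_right _ _)).trans_le (min_le_left _ _)
  have h3 := (hg.trans_le (min_le_right _ _)).trans_le (min_le_right _ _)
  rw [pullbackMass_eq hQ hr g (y := Q z₁) (y' := y) (by linarith) (by linarith)]
  exact mul_pullbackMass_pos hQ
    (fun z hz hd => (h z (ball_subset_closedBall hz) (hd.trans h1)).le)
    ⟨z₁, hz₁, by simpa using g.rOut_pos, mul_ne_zero hJ₁ hJ₁⟩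

theorem det_jacobian_mul_nonneg (hQ : ContDiff ℝ 1 Q) (hinj : Function.Injective Q)
    (hr : ∀ z ∈ sphere z₀ ρ, r ≤ dist (Q z) y₀) {z₁ : ι → ℝ} (hz₁ : z₁ ∈ ball z₀ ρ)
    (hQz₁ : dist (Q z₁) y₀ < r) {z₂ : ι → ℝ} (hz₂ : z₂ ∈ ball z₀ ρ) (hQz₂ : dist (Q z₂) y₀ < r) :
    0 ≤ (jacobian Q z₁).det * (jacobian Q z₂).det := by
  by_contra! hneg
  obtain ⟨ε₁, hε₁, h₁⟩ := exists_mul_pullbackMass_pos hQ hinj hr hz₁ hQz₁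
    (left_ne_zero_of_mul hneg.ne) hQz₂
  obtain ⟨ε₂, hε₂, h₂⟩ := exists_mul_pullbackMass_pos hQ hinj hr hz₂ hQz₂
    (right_ne_zero_of_mul hneg.ne) hQz₂
  have hε : 0 < min ε₁ ε₂ / 2 := half_pos (lt_min hε₁ hε₂)
  have hlt : min ε₁ ε₂ / 2 < min ε₁ ε₂ := half_lt_self (lt_min hε₁ hε₂)
  have h1 := h₁ (bumpAtZero _ hε) (hlt.trans_le (min_le_left _ _))
  have h2 := h₂ (bumpAtZero _ hε) (hlt.trans_le (min_le_right _ _))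
  generalize pullbackMass Q z₀ ρ _ (Q z₂) = m at h1 h2
  nlinarith [mul_pos h1 h2, mul_self_nonneg m]

theorem notMem_interior_det_eq_zero (hQ : ContDiff ℝ 1 Q) (hinj : Function.Injective Q)
    (hr : ∀ z ∈ sphere z₀ ρ, r ≤ dist (Q z) y₀) {z₁ : ι → ℝ} (hz₁ : z₁ ∈ ball z₀ ρ)
    (hQz₁ : dist (Q z₁) y₀ < r) (hJ₁ : (jacobian Q z₁).det ≠ 0) {z₂ : ι → ℝ}
    (hQz₂ : dist (Q z₂) y₀ < r) : z₂ ∉ interior {z | (jacobian Q z).det = 0} := by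
  intro hint
  obtain ⟨δ, hδ, hsep⟩ := exists_dist_lt_imp_mem hQ.continuous hinj (isCompact_closedBall z₀ ρ)
    (mem_interior_iff_mem_nhds.1 hint)
  obtain ⟨ε, hε, h⟩ := exists_mul_pullbackMass_pos hQ hinj hr hz₁ hQz₁ hJ₁ hQz₂
  have hpos : 0 < min δ ε / 2 := half_pos (lt_min hδ hε)
  have hlt : min δ ε / 2 < min δ ε := half_lt_self (lt_min hδ hε)
  have h1 := h (bumpAtZero _ hpos) (hlt.trans_le (min_le_right _ _))
  rw [pullbackMass_eq_zero, mul_zero] at h1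
  · exact lt_irrefl _ h1
  · exact fun z hz hd => hsep z (ball_subset_closedBall hz)
      (hd.trans (hlt.trans_le (min_le_left _ _)))

theorem exists_pos_le_dist_sphere (hQ : Continuous Q) (hinj : Function.Injective Q)
    (hρ : 0 < ρ) : ∃ r > 0, ∀ z ∈ sphere z₀ ρ, r ≤ dist (Q z) (Q z₀) := by
  obtain ⟨r, hr, h⟩ := exists_dist_lt_imp_mem hQ hinj (isCompact_sphere z₀ ρ) (ball_mem_nhds z₀ hρ)
  refine ⟨r, hr, fun z hz => ?_⟩
  by_contra! hlt
  exact (mem_ball.1 (h z hz hlt)).ne hz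

end Local

/-- The critical points of a `C¹` bijection have empty interior. -/
theorem interior_det_jacobian_eq_zero {Q : (ι → ℝ) → ι → ℝ} (hQ : ContDiff ℝ 1 Q)
    (hbij : Function.Bijective Q) : interior {z | (jacobian Q z).det = 0} = ∅ := by
  have hclosed : IsClosed (interior {z | (jacobian Q z).det = 0}) := by
    refine isClosed_of_closure_subset fun z₀ hz₀ => ?_
    obtain ⟨r, hr0, hr⟩ := exists_pos_le_dist_sphere (z₀ := z₀) hQ.continuous hbij.1 one_pos
    have hW : ball z₀ 1 ∩ Q ⁻¹' ball (Q z₀) r ∈ 𝓝 z₀ :=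
      inter_mem (ball_mem_nhds z₀ one_pos)
        (hQ.continuous.continuousAt.preimage_mem_nhds (ball_mem_nhds _ hr0))
    obtain ⟨z₂, hz₂W, hz₂⟩ := mem_closure_iff_nhds.1 hz₀ _ hW
    refine mem_interior_iff_mem_nhds.2 (mem_of_superset hW fun z₁ hz₁ => ?_)
    by_contra hJ₁
    exact notMem_interior_det_eq_zero hQ hbij.1 hr hz₁.1 hz₁.2 hJ₁ hz₂W.2 hz₂
  rcases isClopen_iff.1 ⟨hclosed, isOpen_interior⟩ with h | h
  · exact h
  · exfalso
    have hall : ∀ z, (fderiv ℝ Q z).det = 0 := fun z => by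
      rw [← det_jacobian]
      have hz : z ∈ interior {z | (jacobian Q z).det = 0} := by rw [h]; exact mem_univ z
      exact interior_subset (s := {z | (jacobian Q z).det = 0}) hz
    have := addHaar_image_eq_zero_of_det_fderivWithin_eq_zero volume (s := univ)
      (fun z _ => (hQ.differentiable (by norm_num) z).hasFDerivAt.hasFDerivWithinAt)
      (fun z _ => hall z)
    rw [image_univ, hbij.2.range_eq] at this
    exact (isOpen_univ.measure_ne_zero volume univ_nonempty) this

theorem abs_setIntegral_sub_mul_pullbackMass_le {Q : (ι → ℝ) → ι → ℝ} (hQ : ContDiff ℝ 1 Q)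
    {z₀ y : ι → ℝ} {ρ c k η : ℝ} {g : ContDiffBump (0 : ι → ℝ)} {h : (ι → ℝ) → ℝ}
    (hh : Continuous h)
    (hnn : ∀ z ∈ ball z₀ ρ, dist (Q z) y < g.rOut → 0 ≤ c * (jacobian Q z).det)
    (hk : ∀ z ∈ ball z₀ ρ, dist (Q z) y < g.rOut → |h z - k| ≤ η) :
    |c * (∫ z in ball z₀ ρ, h z * g (Q z - y) * (jacobian Q z).det)
      - k * (c * pullbackMass Q z₀ ρ g y)| ≤ η * (c * pullbackMass Q z₀ ρ g y) := by
  have hJ : Continuous fun z => (jacobian Q z).det := (continuous_jacobian hQ).matrix_det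
  have hQc := hQ.continuous
  have hgc := g.continuous
  have hint : ∀ f : (ι → ℝ) → ℝ, Continuous f → IntegrableOn f (ball z₀ ρ) :=
    fun f hf => integrableOn_pi_ball hf z₀ ρ
  have heq : c * (∫ z in ball z₀ ρ, h z * g (Q z - y) * (jacobian Q z).det)
      - k * (c * pullbackMass Q z₀ ρ g y)
      = ∫ z in ball z₀ ρ, (h z - k) * (g (Q z - y) * (c * (jacobian Q z).det)) := by
    rw [pullbackMass, ← integral_const_mul, ← integral_const_mul, ← integral_const_mul,
      ← integral_sub (hint _ (by fun_prop)) (hint _ (by fun_prop))]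
    refine integral_congr_ae (Eventually.of_forall fun z => ?_)
    simp only
    ring
  have hright : η * (c * pullbackMass Q z₀ ρ g y)
      = ∫ z in ball z₀ ρ, η * (g (Q z - y) * (c * (jacobian Q z).det)) := by
    rw [pullbackMass, ← integral_const_mul, ← integral_const_mul]
    refine integral_congr_ae (Eventually.of_forall fun z => ?_)
    simp only
    ring
  rw [heq, hright, ← Real.norm_eq_abs]
  refine norm_integral_le_of_norm_le (hint _ (by fun_prop)) ?_
  refine (ae_restrict_mem measurableSet_ball).mono fun z hz => ?_
  by_cases hd : dist (Q z) y < g.rOut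
  · have hw := mul_nonneg (g.nonneg (x := Q z - y)) (hnn z hz hd)
    rw [norm_mul, Real.norm_eq_abs, Real.norm_eq_abs, abs_of_nonneg hw]
    exact mul_le_mul_of_nonneg_right (hk z hz hd) hw
  · rw [g.zero_of_le_dist (by simpa [dist_eq_norm] using hd)]; simp

/-- If `dF = ∑ₖ aₖ dQₖ` for a `C¹` bijection `Q` of `ℝ^ι`, then `F ∘ Q⁻¹` has partial derivatives
`aₖ ∘ Q⁻¹`, even at critical values of `Q`. -/
theorem hasDerivAt_comp_rightInverse {Q : (ι → ℝ) → ι → ℝ} (hQ : ContDiff ℝ 1 Q)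
    (hinj : Function.Injective Q) {S : (ι → ℝ) → ι → ℝ} (hS : ∀ y, Q (S y) = y)
    {F : (ι → ℝ) → ℝ} (hF : ContDiff ℝ 1 F) {a : (ι → ℝ) → ι → ℝ} (ha : Continuous a)
    (hFa : ∀ z v, fderiv ℝ F z v = ∑ k, a z k * fderiv ℝ Q z v k) (z₀ e : ι → ℝ) :
    HasDerivAt (fun τ : ℝ => F (S (Q z₀ + τ • e))) (∑ i, a z₀ i * e i) 0 := by
  have hSQ : ∀ z, S (Q z) = z := fun z => hinj (hS _)
  have hint := interior_det_jacobian_eq_zero hQ ⟨hinj, fun y => ⟨S y, hS y⟩⟩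
  have hreg : ∀ z, ∀ V ∈ 𝓝 z, ∃ x ∈ V, (jacobian Q x).det ≠ 0 := fun z V hV => by
    by_contra! hall
    have hz : z ∈ interior {z | (jacobian Q z).det = 0} :=
      mem_interior_iff_mem_nhds.2 (mem_of_superset hV hall)
    rw [hint] at hz
    exact hz
  obtain ⟨r, hr0, hr⟩ := exists_pos_le_dist_sphere (z₀ := z₀) hQ.continuous hinj one_pos
  have hnear : ∀ δ > 0, ball z₀ 1 ∩ Q ⁻¹' ball (Q z₀) δ ∈ 𝓝 z₀ := fun δ hδ =>
    inter_mem (ball_mem_nhds z₀ one_pos)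
      (hQ.continuous.continuousAt.preimage_mem_nhds (ball_mem_nhds _ hδ))
  obtain ⟨z₁, ⟨hz₁, hQz₁⟩, hJ₁⟩ := hreg z₀ _ (hnear r hr0)
  have hQz₁ : dist (Q z₁) (Q z₀) < r := hQz₁
  set c := (jacobian Q z₁).det with hc
  set A : (ι → ℝ) → ℝ := fun z => ∑ i, a z i * e i with hA
  have hAc : Continuous A := by
    have h1 : ∀ i, Continuous fun z => a z i := fun i => (continuous_apply i).comp ha
    exact continuous_finsetSum _ fun i _ => (h1 i).mul continuous_const
  have hclose : ∀ {f : (ι → ℝ) → ℝ}, Continuous f → ∀ (z : ι → ℝ) {η : ℝ}, 0 < η →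
      ∃ ε > 0, ∀ x ∈ closedBall z₀ 1, dist (Q x) (Q z) < ε → |f x - f z| ≤ η :=
    fun hf z η hη => exists_dist_lt_imp_mem (V := {x | |_ - _| ≤ η}) hQ.continuous hinj
      (isCompact_closedBall z₀ 1)
      (by
        filter_upwards [hf.continuousAt.eventually (ball_mem_nhds _ hη)] with x hx
        exact (le_of_lt hx : dist _ _ ≤ η))
  rw [hasDerivAt_iff_isLittleO, Asymptotics.isLittleO_iff]
  intro η hη
  obtain ⟨ε₀, hε₀, hAη⟩ := hclose hAc z₀ hη
  have hsmall : ∀ᶠ τ : ℝ in 𝓝 0, |τ| * ‖e‖ < min ε₀ r / 2 := by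
    have hcont : Continuous fun τ : ℝ => |τ| * ‖e‖ := by fun_prop
    refine hcont.continuousAt.eventually (gt_mem_nhds ?_)
    simpa using half_pos (lt_min hε₀ hr0)
  filter_upwards [hsmall] with τ hτ
  simp only [sub_zero, zero_smul, add_zero, hSQ, Real.norm_eq_abs, smul_eq_mul]
  refine le_of_forall_pos_le_add fun κ hκ => ?_
  set zτ := S (Q z₀ + τ • e) with hzτ
  have hQzτ : Q zτ = Q z₀ + τ • e := hS _
  obtain ⟨ε₁, hε₁, hF₀⟩ := hclose hF.continuous z₀ (half_pos hκ)
  obtain ⟨ε₂, hε₂, hFτ⟩ := hclose hF.continuous zτ (half_pos hκ)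
  set m := min (min ε₀ r / 2) (min ε₁ ε₂) with hm
  have hmpos : 0 < m := lt_min (half_pos (lt_min hε₀ hr0)) (lt_min hε₁ hε₂)
  let g : ContDiffBump (0 : ι → ℝ) := bumpAtZero (m / 2) (half_pos hmpos)
  have hgm : g.rOut < m := half_lt_self hmpos
  have hg₀ : g.rOut < min ε₀ r / 2 := hgm.trans_le (min_le_left _ _)
  have hg₁ : g.rOut < ε₁ := hgm.trans_le ((min_le_right _ _).trans (min_le_left _ _))
  have hg₂ : g.rOut < ε₂ := hgm.trans_le ((min_le_right _ _).trans (min_le_right _ _))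
  have hmin₀ := min_le_left ε₀ r
  have hmin₁ := min_le_right ε₀ r
  have hdist : ∀ s : ℝ, |s| ≤ |τ| → dist (Q z₀ + s • e) (Q z₀) < min ε₀ r / 2 := fun s hs => by
    rw [dist_self_add_left, norm_smul, Real.norm_eq_abs]
    exact (mul_le_mul_of_nonneg_right hs (norm_nonneg e)).trans_lt hτ
  have hnn : ∀ s : ℝ, |s| ≤ |τ| → ∀ z ∈ ball z₀ 1, dist (Q z) (Q z₀ + s • e) < g.rOut →
      0 ≤ c * (jacobian Q z).det := fun s hs z hz hd =>
    det_jacobian_mul_nonneg hQ hinj hr hz₁ hQz₁ hz (by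
      linarith [dist_triangle (Q z) (Q z₀ + s • e) (Q z₀), hdist s hs])
  set D := c * pullbackMass Q z₀ 1 g (Q z₀) with hD
  have hDpos : 0 < D := by
    obtain ⟨x, ⟨hx, hQx⟩, hJx⟩ := hreg z₀ _ (hnear g.rOut g.rOut_pos)
    exact mul_pullbackMass_pos hQ (fun z hz hd => hnn 0 (by simp) z hz (by simpa using hd))
      ⟨x, hx, hQx, mul_ne_zero hJ₁ hJx⟩
  have hDs : ∀ s : ℝ, |s| ≤ |τ| → c * pullbackMass Q z₀ 1 g (Q z₀ + s • e) = D := fun s hs => by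
    rw [pullbackMass_eq hQ hr g (y := Q z₀) (y' := Q z₀ + s • e) (by simp; linarith)
      (by linarith [hdist s hs])]
  set f : ℝ → ℝ := fun s =>
    c * ∫ z in ball z₀ 1, F z * g (Q z - (Q z₀ + s • e)) * (jacobian Q z).det with hf
  have hf₀ : |f 0 - F z₀ * D| ≤ κ / 2 * D := by
    have := abs_setIntegral_sub_mul_pullbackMass_le hQ (k := F z₀) (η := κ / 2) hF.continuous
      (hnn 0 (by simp)) (fun z hz hd => hF₀ z (ball_subset_closedBall hz)
        ((by simpa using hd : dist (Q z) (Q z₀) < g.rOut).trans hg₁))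
    rwa [hDs 0 (by simp)] at this
  have hfτ : |f τ - F zτ * D| ≤ κ / 2 * D := by
    have := abs_setIntegral_sub_mul_pullbackMass_le hQ (k := F zτ) (η := κ / 2) hF.continuous
      (hnn τ le_rfl) (fun z hz hd => hFτ z (ball_subset_closedBall hz)
        (hQzτ ▸ hd.trans hg₂))
    rwa [hDs τ le_rfl] at this
  have habs : ∀ s ∈ uIcc (0 : ℝ) τ, |s| ≤ |τ| := fun s hs => by
    simpa using abs_sub_left_of_mem_uIcc hs
  have hder : ∀ s ∈ uIcc (0 : ℝ) τ, HasDerivWithinAt (fun s => f s - s * (A z₀ * D))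
      (c * (∫ z in ball z₀ 1, A z * g (Q z - (Q z₀ + s • e)) * (jacobian Q z).det) - A z₀ * D)
      (uIcc 0 τ) s := fun s hs => by
    have h1 := (hasDerivAt_setIntegral_ball_translate hQ hF ha hFa (g.contDiff (n := 1))
      (z₀ := z₀) (ρ := 1) (y := Q z₀) (e := e) (τ := s) (fun z hz =>
        sub_notMem_tsupport_of_dist_lt hr hz (by linarith [hdist s (habs s hs)]))).const_mul c
    have h2 := (hasDerivAt_id s).mul_const (A z₀ * D)
    rw [one_mul] at h2
    exact (h1.sub h2).hasDerivWithinAt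
  have hbound : ∀ s ∈ uIcc (0 : ℝ) τ,
      ‖c * (∫ z in ball z₀ 1, A z * g (Q z - (Q z₀ + s • e)) * (jacobian Q z).det) - A z₀ * D‖
        ≤ η * D := fun s hs => by
    have := abs_setIntegral_sub_mul_pullbackMass_le hQ (k := A z₀) (η := η) hAc
      (hnn s (habs s hs)) (fun z hz hd => hAη z (ball_subset_closedBall hz) (by
        linarith [dist_triangle (Q z) (Q z₀ + s • e) (Q z₀), hdist s (habs s hs)]))
    rwa [hDs s (habs s hs)] at this
  have hmv := (convex_uIcc (0 : ℝ) τ).norm_image_sub_le_of_norm_hasDerivWithin_le hder hbound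
    left_mem_uIcc right_mem_uIcc
  simp only [sub_zero, zero_mul, Real.norm_eq_abs] at hmv
  have hfin : |F zτ - F z₀ - τ * A z₀| * D ≤ (η * |τ| + κ) * D := by
    rw [← abs_of_pos hDpos, ← abs_mul, abs_of_pos hDpos]
    calc |(F zτ - F z₀ - τ * A z₀) * D|
        = |(f τ - τ * (A z₀ * D) - f 0) - (f τ - F zτ * D) + (f 0 - F z₀ * D)| := by
          congr 1; ring
      _ ≤ |f τ - τ * (A z₀ * D) - f 0| + |f τ - F zτ * D| + |f 0 - F z₀ * D| :=
          (abs_add_le _ _).trans (add_le_add_left (abs_sub _ _) _)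
      _ ≤ (η * |τ| + κ) * D := by nlinarith
  exact le_of_mul_le_mul_right hfin hDpos

theorem pd_eq_fderiv {f : (ι → ℝ) → ℝ} {v : ι → ℝ} (hf : DifferentiableAt ℝ f v) (i : ι) :
    pd f i v = fderiv ℝ f v (Pi.single i 1) := by
  have h := hf.hasFDerivAt
  rw [← Function.update_eq_self i v] at h
  have := (h.comp_hasDerivAt _ (hasDerivAt_update v i (v i))).deriv
  rwa [Function.update_eq_self] at this

theorem pd_eq_of_hasDerivAt {f : (ι → ℝ) → ℝ} {v : ι → ℝ} {i : ι} {c : ℝ}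
    (h : HasDerivAt (fun τ : ℝ => f (v + τ • Pi.single i 1)) c 0) : pd f i v = c := by
  have hline : (fun s => f (Function.update v i s))
      = (fun τ : ℝ => f (v + τ • Pi.single i 1)) ∘ fun s => s - v i := by
    funext s
    refine congrArg f (funext fun k => ?_)
    rcases eq_or_ne k i with rfl | hk
    · simp
    · simp [hk]
  have h0 : HasDerivAt (fun τ : ℝ => f (v + τ • Pi.single i 1)) c (v i - v i) := by
    rwa [sub_self]
  have := HasDerivAt.comp (h := fun s => s - v i) (v i) h0 ((hasDerivAt_id (v i)).sub_const (v i))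
  rw [mul_one] at this
  rw [pd, hline]
  exact this.deriv

section Legendre

variable {X I : Type*} [Fintype X] [DecidableEq X] [Fintype I] [DecidableEq I]

/-- The partial Legendre transformation `(x, v) ↦ (x, ∂f/∂v)`. -/
noncomputable def legendreMap (f : (X ⊕ I → ℝ) → ℝ) (z : X ⊕ I → ℝ) : X ⊕ I → ℝ :=
  Sum.elim (fun q => z (.inl q)) fun j => fderiv ℝ f z (Pi.single (.inr j) 1)

/-- The energy `v ⬝ ∂f/∂v - f`. -/
noncomputable def legendreEnergy (f : (X ⊕ I → ℝ) → ℝ) (z : X ⊕ I → ℝ) : ℝ :=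
  ∑ j, z (.inr j) * fderiv ℝ f z (Pi.single (.inr j) 1) - f z

theorem contDiff_fderiv_single {f : (ι → ℝ) → ℝ} (hf : ContDiff ℝ 2 f) (k : ι) :
    ContDiff ℝ 1 fun z => fderiv ℝ f z (Pi.single k 1) :=
  (hf.fderiv_right (m := 1) (by norm_num)).clm_apply contDiff_const

theorem contDiff_legendreMap {f : (X ⊕ I → ℝ) → ℝ} (hf : ContDiff ℝ 2 f) :
    ContDiff ℝ 1 (legendreMap f) :=
  contDiff_pi.2 (Sum.rec (fun q => contDiff_apply ℝ ℝ (Sum.inl q : X ⊕ I))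
    fun j => contDiff_fderiv_single hf (.inr j))

theorem contDiff_legendreEnergy {f : (X ⊕ I → ℝ) → ℝ} (hf : ContDiff ℝ 2 f) :
    ContDiff ℝ 1 (legendreEnergy f) :=
  (ContDiff.sum fun j _ => (contDiff_apply ℝ ℝ (Sum.inr j : X ⊕ I)).mul
    (contDiff_fderiv_single hf _)).sub (hf.of_le (by norm_num))

theorem fderiv_legendreEnergy {f : (X ⊕ I → ℝ) → ℝ} (hf : ContDiff ℝ 2 f) (z v : X ⊕ I → ℝ) :
    fderiv ℝ (legendreEnergy f) z v
      = ∑ k, Sum.elim (fun q => -fderiv ℝ f z (Pi.single (.inl q) 1)) (fun j => z (.inr j)) k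
          * fderiv ℝ (legendreMap f) z v k := by
  have hL := (contDiff_legendreMap hf).differentiable (by norm_num) z
  have hP : ∀ j, HasFDerivAt (fun z => fderiv ℝ f z (Pi.single (Sum.inr j : X ⊕ I) 1))
      (fderiv ℝ (fun z => fderiv ℝ f z (Pi.single (Sum.inr j : X ⊕ I) 1)) z) z := fun j =>
    ((contDiff_fderiv_single hf _).differentiable (by norm_num) z).hasFDerivAt
  have hx : ∀ k : X ⊕ I, HasFDerivAt (fun z : X ⊕ I → ℝ => z k)
      (ContinuousLinearMap.proj (R := ℝ) (φ := fun _ : X ⊕ I => ℝ) k) z := fun k =>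
    hasFDerivAt_apply k z
  have h := (HasFDerivAt.fun_sum fun j (_ : j ∈ Finset.univ) => (hx (.inr j)).mul (hP j)).sub
    (hf.differentiable (by norm_num) z).hasFDerivAt
  have hE : fderiv ℝ (legendreEnergy f) z = _ := h.fderiv
  rw [hE, Fintype.sum_sum_type]
  have hl : ∀ q, fderiv ℝ (legendreMap f) z v (.inl q) = v (.inl q) := fun q => by
    rw [fderiv_apply_coord hL]
    exact congrArg (fun A : (X ⊕ I → ℝ) →L[ℝ] ℝ => A v) (hx (.inl q)).fderiv
  have hr : ∀ j, fderiv ℝ (legendreMap f) z v (.inr j)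
      = fderiv ℝ (fun z => fderiv ℝ f z (Pi.single (Sum.inr j : X ⊕ I) 1)) z v := fun j => by
    rw [fderiv_apply_coord hL]
    rfl
  simp only [hl, hr, Sum.elim_inl, Sum.elim_inr, sub_apply,
    sum_apply, add_apply, smul_apply,
    ContinuousLinearMap.proj_apply, smul_eq_mul, Finset.sum_add_distrib, neg_mul,
    Finset.sum_neg_distrib]
  rw [apply_eq_sum_single (fderiv ℝ f z) v, Fintype.sum_sum_type]
  simp only [mul_comm (v _)]
  ring

/-- The directional derivatives of the Legendre transform of a `C²` function, whose partial
Legendre transformation is a bijection with a possibly non-differentiable inverse `S`. -/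
theorem hasDerivAt_legendreEnergy_comp {f : (X ⊕ I → ℝ) → ℝ} (hf : ContDiff ℝ 2 f)
    {S : (X ⊕ I → ℝ) → X ⊕ I → ℝ} (hl : Function.LeftInverse S (legendreMap f))
    (hr : Function.RightInverse S (legendreMap f)) (z e : X ⊕ I → ℝ) :
    HasDerivAt (fun τ : ℝ => legendreEnergy f (S (legendreMap f z + τ • e)))
      (∑ k, Sum.elim (fun q => -fderiv ℝ f z (Pi.single (.inl q) 1)) (fun j => z (.inr j)) k
        * e k) 0 := by
  refine hasDerivAt_comp_rightInverse (contDiff_legendreMap hf) hl.injective hr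
    (contDiff_legendreEnergy hf)
    (a := fun z => Sum.elim (fun q => -fderiv ℝ f z (Pi.single (.inl q) 1)) fun j => z (.inr j))
    (continuous_pi ?_) (fderiv_legendreEnergy hf) z e
  rintro (q | j)
  · exact (contDiff_fderiv_single hf _).continuous.neg
  · exact continuous_apply _

end Legendre

section Hamiltonian

variable {φ : Fin κ → (Fin m → ℝ) → (Idx m κ → ℝ) → ℝ → ℝ}
  {L : (Idx m κ → ℝ) → (Idx m κ → ℝ) → ℝ → ℝ}
  {ηhat : (Idx m κ → ℝ) → (Fin m → ℝ) → ℝ → Fin m → ℝ}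

/-- The reduced Lagrangian at a fixed time, as a function of the single vector `(x, v)`. -/
noncomputable def jointLstar (L : (Idx m κ → ℝ) → (Idx m κ → ℝ) → ℝ → ℝ)
    (φ : Fin κ → (Fin m → ℝ) → (Idx m κ → ℝ) → ℝ → ℝ) (t : ℝ) (z : Idx m κ ⊕ Fin m → ℝ) : ℝ :=
  Lstar L φ (fun j => z (.inr j)) (fun q => z (.inl q)) t

theorem contDiff_jointLstar
    (hφ : ∀ α, ContDiff ℝ 2
      (fun z : (Fin m → ℝ) × (Idx m κ → ℝ) × ℝ => φ α z.1 z.2.1 z.2.2))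
    (hL : ContDiff ℝ 2
      (fun z : (Idx m κ → ℝ) × (Idx m κ → ℝ) × ℝ => L z.1 z.2.1 z.2.2)) (t : ℝ) :
    ContDiff ℝ 2 (jointLstar L φ t) := by
  have hv : ContDiff ℝ 2 fun z : Idx m κ ⊕ Fin m → ℝ => fun j : Fin m => z (.inr j) :=
    contDiff_pi.2 fun j => contDiff_apply ℝ ℝ _
  have hx : ContDiff ℝ 2 fun z : Idx m κ ⊕ Fin m → ℝ => fun q : Idx m κ => z (.inl q) :=
    contDiff_pi.2 fun j => contDiff_apply ℝ ℝ _
  have he : ContDiff ℝ 2 fun z : Idx m κ ⊕ Fin m → ℝ =>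
      etaExt φ (fun j => z (.inr j)) (fun q => z (.inl q)) t :=
    contDiff_pi.2 (Sum.rec (fun i => contDiff_apply ℝ ℝ (Sum.inr i : Idx m κ ⊕ Fin m))
      fun α => (hφ α).comp (hv.prodMk (hx.prodMk contDiff_const)))
  exact hL.comp (he.prodMk (hx.prodMk contDiff_const))

theorem jointLstar_elim (v : Fin m → ℝ) (x : Idx m κ → ℝ) (t : ℝ) :
    jointLstar L φ t (Sum.elim x v) = Lstar L φ v x t := rfl

theorem fderiv_jointLstar_inr {t : ℝ} (hf : ContDiff ℝ 2 (jointLstar L φ t)) (v : Fin m → ℝ)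
    (x : Idx m κ → ℝ) (j : Fin m) :
    fderiv ℝ (jointLstar L φ t) (Sum.elim x v) (Pi.single (.inr j) 1) = pLstar L φ j v x t := by
  rw [← pd_eq_fderiv (hf.differentiable (by norm_num) _), pLstar, pd, pd]
  simp only [Sum.elim_inr, Sum.update_elim_inr, jointLstar_elim]

theorem fderiv_jointLstar_inl {t : ℝ} (hf : ContDiff ℝ 2 (jointLstar L φ t)) (v : Fin m → ℝ)
    (x : Idx m κ → ℝ) (q : Idx m κ) :
    fderiv ℝ (jointLstar L φ t) (Sum.elim x v) (Pi.single (.inl q) 1)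
      = pd (fun x' => Lstar L φ v x' t) q x := by
  rw [← pd_eq_fderiv (hf.differentiable (by norm_num) _), pd, pd]
  simp only [Sum.elim_inl, Sum.update_elim_inl, jointLstar_elim]

theorem legendreMap_jointLstar {t : ℝ} (hf : ContDiff ℝ 2 (jointLstar L φ t)) (v : Fin m → ℝ)
    (x : Idx m κ → ℝ) :
    legendreMap (jointLstar L φ t) (Sum.elim x v)
      = Sum.elim x fun j => pLstar L φ j v x t := by
  simp only [legendreMap, fderiv_jointLstar_inr hf, Sum.elim_inl]

theorem legendreEnergy_jointLstar {t : ℝ} (hf : ContDiff ℝ 2 (jointLstar L φ t))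
    (hleg₁ : ∀ x y j, pLstar L φ j (ηhat x y t) x t = y j) (x : Idx m κ → ℝ) (y : Fin m → ℝ) :
    legendreEnergy (jointLstar L φ t) (Sum.elim x (ηhat x y t)) = Hstar L φ ηhat x y t := by
  simp only [legendreEnergy, fderiv_jointLstar_inr hf, Sum.elim_inr, hleg₁, Hstar, jointLstar_elim]

/-- Joint directional derivatives of the reduced Hamiltonian at the reduced momenta. -/
theorem hasDerivAt_Hstar {t : ℝ} (hf : ContDiff ℝ 2 (jointLstar L φ t))
    (hleg₁ : ∀ x y j, pLstar L φ j (ηhat x y t) x t = y j)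
    (hleg₂ : ∀ x (v : Fin m → ℝ), ηhat x (fun j => pLstar L φ j v x t) t = v)
    (v : Fin m → ℝ) (x : Idx m κ → ℝ) (dx : Idx m κ → ℝ) (dy : Fin m → ℝ) :
    HasDerivAt (fun τ : ℝ =>
        Hstar L φ ηhat (x + τ • dx) ((fun j => pLstar L φ j v x t) + τ • dy) t)
      (∑ j, v j * dy j - ∑ q, pd (fun x' => Lstar L φ v x' t) q x * dx q) 0 := by
  let S : (Idx m κ ⊕ Fin m → ℝ) → Idx m κ ⊕ Fin m → ℝ := fun w =>
    Sum.elim (fun q => w (.inl q)) (ηhat (fun q => w (.inl q)) (fun j => w (.inr j)) t)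
  have helim : ∀ w : Idx m κ ⊕ Fin m → ℝ,
      Sum.elim (fun q => w (.inl q)) (fun j => w (.inr j)) = w := fun w =>
    Sum.elim_comp_inl_inr w
  have hl : Function.LeftInverse S (legendreMap (jointLstar L φ t)) := fun w => by
    rw [← helim w, legendreMap_jointLstar hf]
    simp only [S, Sum.elim_inl, Sum.elim_inr, hleg₂]
  have hr : Function.RightInverse S (legendreMap (jointLstar L φ t)) := fun w => by
    simp only [S, legendreMap_jointLstar hf, hleg₁, helim]
  have h := hasDerivAt_legendreEnergy_comp hf hl hr (Sum.elim x v) (Sum.elim dx dy)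
  simp only [legendreMap_jointLstar hf, Fintype.sum_sum_type, Sum.elim_inl, Sum.elim_inr,
    fderiv_jointLstar_inl hf, neg_mul, Finset.sum_neg_distrib] at h
  convert h using 1
  · funext τ
    exact (legendreEnergy_jointLstar hf hleg₁ _ _).symm
  · rw [sub_eq_neg_add, Fintype.sum_sum_type]

theorem pd_Hstar_momentum {t : ℝ} (hf : ContDiff ℝ 2 (jointLstar L φ t))
    (hleg₁ : ∀ x y j, pLstar L φ j (ηhat x y t) x t = y j)
    (hleg₂ : ∀ x (v : Fin m → ℝ), ηhat x (fun j => pLstar L φ j v x t) t = v)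
    (v : Fin m → ℝ) (x : Idx m κ → ℝ) (j : Fin m) :
    pd (fun w => Hstar L φ ηhat x w t) j (fun k => pLstar L φ k v x t) = v j := by
  refine pd_eq_of_hasDerivAt ?_
  simpa [Pi.single_apply] using hasDerivAt_Hstar hf hleg₁ hleg₂ v x 0 (Pi.single j 1)

theorem pd_Hstar_position {t : ℝ} (hf : ContDiff ℝ 2 (jointLstar L φ t))
    (hleg₁ : ∀ x y j, pLstar L φ j (ηhat x y t) x t = y j)
    (hleg₂ : ∀ x (v : Fin m → ℝ), ηhat x (fun j => pLstar L φ j v x t) t = v)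
    (v : Fin m → ℝ) (x : Idx m κ → ℝ) (q : Idx m κ) :
    pd (fun x' => Hstar L φ ηhat x' (fun k => pLstar L φ k v x t) t) q x
      = -pd (fun x' => Lstar L φ v x' t) q x := by
  refine pd_eq_of_hasDerivAt ?_
  have h := hasDerivAt_Hstar hf hleg₁ hleg₂ v x (Pi.single q 1) 0
  simpa only [Pi.zero_apply, mul_zero, Finset.sum_const_zero, zero_sub, smul_zero, add_zero,
    Pi.single_apply, mul_ite, mul_one, Finset.sum_ite_eq', Finset.sum_ite_eq, Finset.mem_univ,
    if_true] using h

theorem Xstar_Hstar {t : ℝ} (hf : ContDiff ℝ 2 (jointLstar L φ t))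
    (hleg₁ : ∀ x y j, pLstar L φ j (ηhat x y t) x t = y j)
    (hleg₂ : ∀ x (v : Fin m → ℝ), ηhat x (fun j => pLstar L φ j v x t) t = v)
    (ξ : Idx m κ → (Idx m κ → ℝ) → Idx m κ → ℝ) (v : Fin m → ℝ) (x : Idx m κ → ℝ) (j : Fin m) :
    Xstar ξ φ j (fun x' t' => Hstar L φ ηhat x' (fun k => pLstar L φ k v x t) t') v x t
      = -Xstar ξ φ j (fun x' t' => Lstar L φ v x' t') v x t := by
  simp only [Xstar, Xp, pd_Hstar_position hf hleg₁ hleg₂, mul_neg, Finset.sum_neg_distrib]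
  ring

end Hamiltonian

end Auxiliary

/-- **Poincaré equations ⟺ Poincaré–Hamilton equations (4.17).** -/
theorem poincare_iff_poincare_hamilton {m κ : ℕ}
    (ξ : Idx m κ → (Idx m κ → ℝ) → Idx m κ → ℝ)
    (ξ0 : (Idx m κ → ℝ) → ℝ → Idx m κ → ℝ)
    (C0 : Idx m κ → Idx m κ → (Idx m κ → ℝ) → ℝ → ℝ)
    (C : Idx m κ → Idx m κ → Idx m κ → (Idx m κ → ℝ) → ℝ → ℝ)
    (φ : Fin κ → (Fin m → ℝ) → (Idx m κ → ℝ) → ℝ → ℝ)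
    (L : (Idx m κ → ℝ) → (Idx m κ → ℝ) → ℝ → ℝ)
    (hξ : ∀ p, ContDiff ℝ 2 (ξ p))
    (hξ0 : ContDiff ℝ 2 (fun z : (Idx m κ → ℝ) × ℝ => ξ0 z.1 z.2))
    (hind : ∀ x : Idx m κ → ℝ, LinearIndependent ℝ fun p => ξ p x)
    (hφ : ∀ α, ContDiff ℝ 2
      (fun z : (Fin m → ℝ) × (Idx m κ → ℝ) × ℝ => φ α z.1 z.2.1 z.2.2))
    (hL : ContDiff ℝ 2
      (fun z : (Idx m κ → ℝ) × (Idx m κ → ℝ) × ℝ => L z.1 z.2.1 z.2.2))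
    (hcomm0 : ∀ p (G : (Idx m κ → ℝ) → ℝ → ℝ),
      ContDiff ℝ 2 (fun z : (Idx m κ → ℝ) × ℝ => G z.1 z.2) →
      ∀ x t, X0 ξ0 (Xp ξ p G) x t - Xp ξ p (X0 ξ0 G) x t
        = ∑ q, C0 p q x t * Xp ξ q G x t)
    (hcomm : ∀ p q (G : (Idx m κ → ℝ) → ℝ → ℝ),
      ContDiff ℝ 2 (fun z : (Idx m κ → ℝ) × ℝ => G z.1 z.2) →
      ∀ x t, Xp ξ p (Xp ξ q G) x t - Xp ξ q (Xp ξ p G) x t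
        = ∑ r, C p q r x t * Xp ξ r G x t)
    -- the Legendre transformation `η ↦ ∂L*/∂η` is invertible, with inverse `ηhat`
    (ηhat : (Idx m κ → ℝ) → (Fin m → ℝ) → ℝ → Fin m → ℝ)
    (hleg₁ : ∀ x y t j, pLstar L φ j (ηhat x y t) x t = y j)
    (hleg₂ : ∀ x (v : Fin m → ℝ) t, ηhat x (fun j => pLstar L φ j v x t) t = v)
    -- the C² motion, its Poincaré parameters, and the constraints
    (xc : ℝ → Idx m κ → ℝ) (hxc : ContDiff ℝ 2 xc)
    (η : ℝ → Idx m κ → ℝ)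
    (hη : ∀ p t, deriv (fun τ => xc τ p) t
      = ξ0 (xc t) t p + ∑ q, η t q * ξ q (xc t) p)
    (hcon : ∀ α t, η t (.inr α) = φ α (vmOf η t) (xc t) t) :
    -- the multiplier-free Poincaré equations …
    (∀ t (j : Fin m), PoincareLHS ξ C0 C φ L xc η j t = 0)
    ↔
    -- … hold iff the curve `(x(t), y*(t))`, `y*_j(t) = (∂L*/∂η_j)(η(t),x(t),t)`,
    -- satisfies the Poincaré–Hamilton equations
    ((∀ t (j : Fin m),
        η t (.inl j)
          = pd (fun w => Hstar L φ ηhat (xc t) w t) j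
              (fun k' => pLstar L φ k' (vmOf η t) (xc t) t))
      ∧
      (∀ t (j : Fin m),
        deriv (fun τ => pLstar L φ j (vmOf η τ) (xc τ) τ) t
          = - Xstar ξ φ j
                (fun x' t' => Hstar L φ ηhat x'
                  (fun k' => pLstar L φ k' (vmOf η t) (xc t) t) t')
                (vmOf η t) (xc t) t
            + (∑ k', (K0 C0 φ j (.inl k') (vmOf η t) (xc t) t
                + ∑ q, Kq C φ q j (.inl k') (vmOf η t) (xc t) t * η t q)
                * pLstar L φ k' (vmOf η t) (xc t) t)
            + ∑ α, Astar ξ C0 C φ xc (vmOf η) j α t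
                * pEta L (.inr α) (etaExt φ (vmOf η t) (xc t) t) (xc t) t)) := by
  have hvm : ∀ t i, η t (.inl i) = vmOf η t i := fun _ _ => rfl
  have hf := contDiff_jointLstar hφ hL
  have hX := fun t j => Xstar_Hstar (hf t) (fun x y => hleg₁ x y t) (fun x v => hleg₂ x v t) ξ
    (vmOf η t) (xc t) j
  have hy := fun t j => pd_Hstar_momentum (hf t) (fun x y => hleg₁ x y t)
    (fun x v => hleg₂ x v t) (vmOf η t) (xc t) j
  simp only [hX, hy, hvm, implies_true, true_and, neg_neg, PoincareLHS]
  refine forall_congr' fun t => forall_congr' fun j => ?_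
  constructor <;> intro h <;> linarith

end NNH
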